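/- arXiv:1507.03823 — 6 statements merged into one kernel-verified Lean document; each statement's English description precedes it below -/
import Mathlib

section
/- For every array index r ∈ {1,…,k}, every position l ∈ {1,…,n_r}, and every query index i ∈ {1,…,m}, the set {x ∈ W : A_r[l](x) < q_i(x)} (where A_r[l](x) and q_i(x) denote the corresponding coordinates of the configuration x) is both open and closed in the subspace topology of W. -/
/-- A configuration: `k` arrays (array `i` has `sizes i` real entries),
`m` query values, and `m` answer values. As a finite product of copies of `ℝ`,
it carries the (Euclidean) product topology. -/
abbrev Config (k m : ℕ) (sizes : Fin k → ℕ) : Type :=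
  ((i : Fin k) → Fin (sizes i) → ℝ) × (Fin m → ℝ) × (Fin m → ℝ)

/-- The set `W` of valid configurations: every array is nondecreasing and, for each
query index `j`, the answer `p j` is the strict predecessor of the query `q j` among
all array entries: `p j` is some array entry, `p j < q j`, and every array entry
smaller than `q j` is at most `p j`. -/
def W (k m : ℕ) (sizes : Fin k → ℕ) : Set (Config k m sizes) :=
  { x | (∀ i : Fin k, Monotone (x.1 i)) ∧
        ∀ j : Fin m,
          (∃ (r : Fin k) (l : Fin (sizes r)), x.1 r l = x.2.2 j) ∧
          x.2.2 j < x.2.1 j ∧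
          ∀ (r : Fin k) (l : Fin (sizes r)), x.1 r l < x.2.1 j → x.1 r l ≤ x.2.2 j }

/-- On `W`, an entry is smaller than a query exactly when it is at most the answer. -/
theorem entry_lt_query_iff_le_answer {k m : ℕ} {sizes : Fin k → ℕ} {x : Config k m sizes}
    (hx : x ∈ W k m sizes) (r : Fin k) (l : Fin (sizes r)) (i : Fin m) :
    x.1 r l < x.2.1 i ↔ x.1 r l ≤ x.2.2 i :=
  ⟨(hx.2 i).2.2 r l, fun h => h.trans_lt (hx.2 i).2.1⟩

/-- For any array index `r`, position `l`, and query index `i`, the set of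
configurations in `W` whose entry `A_r[l]` is smaller than the query `q_i`
is both open and closed in the subspace topology of `W`. -/
theorem stmt1 (k m : ℕ) (sizes : Fin k → ℕ)
    (hk : 1 ≤ k) (hm : 1 ≤ m) (hsizes : ∀ i, 1 ≤ sizes i)
    (r : Fin k) (l : Fin (sizes r)) (i : Fin m) :
    IsOpen {x : W k m sizes | (x : Config k m sizes).1 r l < (x : Config k m sizes).2.1 i} ∧
    IsClosed {x : W k m sizes | (x : Config k m sizes).1 r l < (x : Config k m sizes).2.1 i} := by
  constructor
  · exact isOpen_lt (by fun_prop) (by fun_prop)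
  · have h : {x : W k m sizes | (x : Config k m sizes).1 r l < (x : Config k m sizes).2.1 i} =
        {x : W k m sizes | (x : Config k m sizes).1 r l ≤ (x : Config k m sizes).2.2 i} :=
      Set.ext fun x => entry_lt_query_iff_le_answer x.2 r l i
    rw [h]
    exact isClosed_le (by fun_prop) (by fun_prop)
end

section
/- If two configurations x and y belong to the same connected component of W, then for every array index r ∈ {1,…,k}, every position l ∈ {1,…,n_r}, and every query index i ∈ {1,…,m}: A_r[l](x) < q_i(x) if and only if A_r[l](y) < q_i(y). In other words, the relative order between any array entry and any query value is an invariant of the connected components of W. -/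
/-- On a preconnected subset of `W`, an array entry that is below a query value in one
configuration is below it in every configuration. -/
theorem entry_lt_query_of_isPreconnected {k m : ℕ} {sizes : Fin k → ℕ}
    {S : Set (Config k m sizes)} (hS : IsPreconnected S) (hSW : S ⊆ W k m sizes)
    {x y : Config k m sizes} (hx : x ∈ S) (hy : y ∈ S)
    (r : Fin k) (l : Fin (sizes r)) (i : Fin m) (h : x.1 r l < x.2.1 i) :
    y.1 r l < y.2.1 i := by
  by_contra hyq
  have hU : IsOpen {z : Config k m sizes | z.1 r l < z.2.1 i} :=
    isOpen_lt (by fun_prop) (by fun_prop)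
  have hV : IsOpen {z : Config k m sizes | z.2.2 i < z.1 r l} :=
    isOpen_lt (by fun_prop) (by fun_prop)
  have hcover : S ⊆ {z | z.1 r l < z.2.1 i} ∪ {z | z.2.2 i < z.1 r l} := fun z hz =>
    (lt_or_ge (z.1 r l) (z.2.1 i)).imp id fun hle => ((hSW hz).2 i).2.1.trans_le hle
  obtain ⟨z, hzS, hzq, hzp⟩ := hS _ _ hU hV hcover ⟨x, hx, h⟩
    ⟨y, hy, ((hSW hy).2 i).2.1.trans_le (not_lt.mp hyq)⟩
  exact (((hSW hzS).2 i).2.2 r l hzq).not_gt hzp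

/-- If `x` and `y` lie in the same connected component of `W`, then the relative order
between any array entry and any query value is the same in `x` and in `y`. -/
theorem stmt2 (k m : ℕ) (sizes : Fin k → ℕ)
    (hk : 1 ≤ k) (hm : 1 ≤ m) (hsizes : ∀ i, 1 ≤ sizes i)
    (x y : Config k m sizes) (hx : x ∈ W k m sizes)
    (hy : y ∈ connectedComponentIn (W k m sizes) x)
    (r : Fin k) (l : Fin (sizes r)) (i : Fin m) :
    (x.1 r l < x.2.1 i ↔ y.1 r l < y.2.1 i) := by
  have hS : IsPreconnected (connectedComponentIn (W k m sizes) x) :=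
    isPreconnected_connectedComponentIn
  have hSW := connectedComponentIn_subset (W k m sizes) x
  have hxS := mem_connectedComponentIn hx
  exact ⟨entry_lt_query_of_isPreconnected hS hSW hxS hy r l i,
    entry_lt_query_of_isPreconnected hS hSW hy hxS r l i⟩
end

section
/- Suppose n ≥ 2 and m = n − 1. Then the number of connected components of W is at least the multinomial coefficient n! / (n_1! · n_2! ⋯ n_k!). -/
theorem isClopen_setOf_entry_lt_query {k m : ℕ} {sizes : Fin k → ℕ} (r : Fin k)
    (l : Fin (sizes r)) (j : Fin m) :
    IsClopen {x : W k m sizes | x.1.1 r l < x.1.2.1 j} := by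
  constructor
  · have h : {x : W k m sizes | x.1.1 r l < x.1.2.1 j} =
        {x : W k m sizes | x.1.1 r l ≤ x.1.2.2 j} := by
      ext x
      exact ⟨(x.2.2 j).2.2 r l, fun h => lt_of_le_of_lt h (x.2.2 j).2.1⟩
    rw [h]
    exact isClosed_le (by fun_prop) (by fun_prop)
  · exact isOpen_lt (by fun_prop) (by fun_prop)

theorem entry_lt_query_iff_of_connectedComponents_eq {k m : ℕ} {sizes : Fin k → ℕ}
    {x y : W k m sizes} (h : (x : ConnectedComponents (W k m sizes)) = y)
    (r : Fin k) (l : Fin (sizes r)) (j : Fin m) :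
    x.1.1 r l < x.1.2.1 j ↔ y.1.1 r l < y.1.2.1 j := by
  rw [ConnectedComponents.coe_eq_coe] at h
  have hs := isClopen_setOf_entry_lt_query r l j
  constructor <;> intro hx
  · exact hs.connectedComponent_subset hx (h ▸ mem_connectedComponent)
  · exact hs.connectedComponent_subset hx (h ▸ mem_connectedComponent)

/-- The permutation of the positions of array `i` that sorts the values of a labelling. -/
def sortingPerm {k n : ℕ} {sizes : Fin k → ℕ} (e : (Σ i, Fin (sizes i)) ≃ Fin n) (i : Fin k) :
    Equiv.Perm (Fin (sizes i)) :=
  Tuple.sort fun l => e ⟨i, l⟩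

/-- The arrays obtained from a labelling by sorting the labels inside each array. -/
def sortedLabels {k n : ℕ} {sizes : Fin k → ℕ} (e : (Σ i, Fin (sizes i)) ≃ Fin n) (i : Fin k)
    (l : Fin (sizes i)) : Fin n :=
  e ⟨i, sortingPerm e i l⟩

/-- The valid configuration whose arrays are the sorted labels, with the answer `j` to the
query `j + 1`. -/
def labelledConfig {k n : ℕ} {sizes : Fin k → ℕ} (e : (Σ i, Fin (sizes i)) ≃ Fin n) :
    W k (n - 1) sizes :=
  ⟨(fun i l => ((sortedLabels e i l : ℕ) : ℝ), fun j => ((j + 1 : ℕ) : ℝ), fun j => ((j : ℕ) : ℝ)),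
    fun i a b hab => Nat.cast_le.2 (Fin.le_def.1 (Tuple.monotone_sort (fun l => e ⟨i, l⟩) hab)),
    fun j => by
      refine ⟨?_, Nat.cast_lt.2 (Nat.lt_succ_self _), fun r l h =>
        Nat.cast_le.2 (Nat.lt_succ_iff.1 (Nat.cast_lt.1 h))⟩
      obtain ⟨⟨r, l⟩, h⟩ := e.surjective ⟨j, by omega⟩
      refine ⟨r, (sortingPerm e r).symm l, ?_⟩
      simp [sortedLabels, h]⟩

theorem sortedLabels_eq_of_connectedComponents_eq {k n : ℕ} {sizes : Fin k → ℕ}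
    {e e' : (Σ i, Fin (sizes i)) ≃ Fin n}
    (h : (labelledConfig e : ConnectedComponents (W k (n - 1) sizes)) = labelledConfig e') :
    sortedLabels e = sortedLabels e' := by
  funext r l
  have key (j : Fin (n - 1)) :
      (sortedLabels e r l : ℕ) < j + 1 ↔ (sortedLabels e' r l : ℕ) < j + 1 := by
    have := entry_lt_query_iff_of_connectedComponents_eq h r l j
    simpa only [labelledConfig, Nat.cast_lt] using this
  ext
  rcases lt_trichotomy (sortedLabels e r l : ℕ) (sortedLabels e' r l) with hlt | heq | hlt
  · have := key ⟨sortedLabels e r l, by omega⟩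
    simp only at this
    omega
  · exact heq
  · have := key ⟨sortedLabels e' r l, by omega⟩
    simp only at this
    omega

theorem injective_component_sortingPerm {k n : ℕ} (sizes : Fin k → ℕ) :
    Function.Injective fun e : (Σ i, Fin (sizes i)) ≃ Fin n =>
      ((labelledConfig e : ConnectedComponents (W k (n - 1) sizes)), sortingPerm e) := by
  intro e e' h
  obtain ⟨hc, hs⟩ := Prod.mk.inj h
  have hl := sortedLabels_eq_of_connectedComponents_eq hc
  ext1 ⟨i, l⟩
  have := congr_fun (congr_fun hl i) ((sortingPerm e i).symm l)
  simp only [sortedLabels, ← hs, Equiv.apply_symm_apply] at this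
  exact this

open Finset in
/-- With `n ≥ 2` and `m = n - 1` queries, the number of connected components of `W`
is at least the multinomial coefficient `n! / (n₁! ⋯ n_k!)`. -/
theorem stmt4 (k m n : ℕ) (sizes : Fin k → ℕ)
    (hk : 1 ≤ k) (hsizes : ∀ i, 1 ≤ sizes i) (hn : n = ∑ i, sizes i)
    (hn2 : 2 ≤ n) (hm : m = n - 1) :
    (↑(n.factorial / ∏ i, (sizes i).factorial) : Cardinal) ≤
      Cardinal.mk (ConnectedComponents (W k m sizes)) := by
  subst hm
  rcases finite_or_infinite (ConnectedComponents (W k (n - 1) sizes)) with hfin | hinf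
  · rw [← Nat.cast_card, Nat.cast_le]
    refine Nat.div_le_of_le_mul ?_
    have h := Nat.card_le_card_of_injective _ (injective_component_sortingPerm (n := n) sizes)
    have e : (Σ i, Fin (sizes i)) ≃ Fin n := finSigmaFinEquiv.trans (finCongr hn.symm)
    rw [Nat.card_prod, Nat.card_pi, Nat.card_eq_fintype_card, Fintype.card_equiv e] at h
    simpa [Nat.card_eq_fintype_card, Fintype.card_perm, ← hn, mul_comm] using h
  · exact Cardinal.natCast_le_aleph0.trans (Cardinal.aleph0_le_mk _)
end

section
/- Let n and k be positive integers, write n = k·⌊n/k⌋ + r with 0 ≤ r < k. For every tuple of nonnegative integers (n_1,…,n_k) with n_1+⋯+n_k = n, the multinomial coefficient satisfies n!/(n_1!⋯n_k!) ≤ n! / ( (⌊n/k⌋!)^{k−r} · (⌈n/k⌉!)^{r} ); equivalently, n_1!·n_2!⋯n_k! ≥ (⌊n/k⌋!)^{k−r} · (⌈n/k⌉!)^{r}. That is, the multinomial coefficient n!/(n_1!⋯n_k!) over all compositions of n into k nonnegative parts is maximized when the parts are balanced, i.e., when every part equals ⌊n/k⌋ or ⌈n/k⌉. -/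
open Finset

theorem factorial_mul_succ_pow_le (q m : ℕ) :
    q.factorial * (q + 1) ^ m ≤ m.factorial * (q + 1) ^ q := by
  rcases le_total q m with h | h
  · obtain ⟨d, rfl⟩ := Nat.exists_eq_add_of_le h
    calc q.factorial * (q + 1) ^ (q + d)
        = q.factorial * (q + 1) ^ d * (q + 1) ^ q := by ring
      _ ≤ (q + d).factorial * (q + 1) ^ q :=
        Nat.mul_le_mul_right _ Nat.factorial_mul_pow_le_factorial
  · obtain ⟨d, rfl⟩ := Nat.exists_eq_add_of_le h
    calc (m + d).factorial * (m + d + 1) ^ m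
        = m.factorial * (m + 1).ascFactorial d * (m + d + 1) ^ m := by
          rw [Nat.factorial_mul_ascFactorial]
      _ ≤ m.factorial * (m + d + 1) ^ d * (m + d + 1) ^ m := by
          gcongr
          exact (Nat.ascFactorial_le_pow_add m d).trans (Nat.pow_le_pow_left (Nat.le_succ _) d)
      _ = m.factorial * (m + d + 1) ^ (m + d) := by ring

theorem balanced_prod_factorial_le {ι : Type*} (s : Finset ι) (hs : s.Nonempty) (f : ι → ℕ) :
    ((∑ i ∈ s, f i) / #s).factorial ^ (#s - (∑ i ∈ s, f i) % #s) *
        ((∑ i ∈ s, f i) / #s + 1).factorial ^ ((∑ i ∈ s, f i) % #s) ≤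
      ∏ i ∈ s, (f i).factorial := by
  have hprod := Finset.prod_le_prod' (s := s)
    fun i _ ↦ factorial_mul_succ_pow_le ((∑ i ∈ s, f i) / #s) (f i)
  simp only [Finset.prod_mul_distrib, Finset.prod_const, Finset.prod_pow_eq_pow_sum] at hprod
  have hdiv := Nat.div_add_mod (∑ i ∈ s, f i) #s
  have hr := (Nat.mod_lt (∑ i ∈ s, f i) hs.card_pos).le
  generalize (∑ i ∈ s, f i) / #s = q at *
  generalize (∑ i ∈ s, f i) % #s = r at *
  rw [← hdiv] at hprod
  refine Nat.le_of_mul_le_mul_right (c := ((q + 1) ^ q) ^ #s) (le_trans (le_of_eq ?_) hprod)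
    (by positivity)
  rw [Nat.factorial_succ, mul_pow, ← Nat.sub_add_cancel hr, Nat.add_sub_cancel]
  ring

/-- Among all compositions `n₁ + ⋯ + n_k = n` of `n` into `k` nonnegative parts,
the multinomial coefficient `n!/(n₁!⋯n_k!)` is maximized by the balanced composition
with `n % k` parts equal to `⌈n/k⌉ = n/k + 1` and `k - n % k` parts equal to `⌊n/k⌋`:
`n!/(n₁!⋯n_k!) ≤ n! / ((⌊n/k⌋!)^(k - n % k) · (⌈n/k⌉!)^(n % k))`, equivalently
`n₁!⋯n_k! ≥ (⌊n/k⌋!)^(k - n % k) · (⌈n/k⌉!)^(n % k)`. -/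
theorem stmt7 (n k : ℕ) (hn : 0 < n) (hk : 0 < k)
    (sizes : Fin k → ℕ) (hsum : ∑ i, sizes i = n) :
    n.factorial / ∏ i, (sizes i).factorial ≤
      n.factorial / ((n / k).factorial ^ (k - n % k) * (n / k + 1).factorial ^ (n % k)) ∧
    (n / k).factorial ^ (k - n % k) * (n / k + 1).factorial ^ (n % k) ≤
      ∏ i, (sizes i).factorial := by
  have h : (n / k).factorial ^ (k - n % k) * (n / k + 1).factorial ^ (n % k) ≤
      ∏ i, (sizes i).factorial := by
    have : Nonempty (Fin k) := ⟨⟨0, hk⟩⟩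
    simpa [hsum] using balanced_prod_factorial_le univ univ_nonempty sizes
  exact ⟨Nat.div_le_div_left h (by positivity), h⟩
end

section
/- Let x = ((A_1,…,A_k), q, p) ∈ W, let r ≠ r' be two array indices, and let l ∈ {1,…,n_r}, l' ∈ {1,…,n_{r'}} be positions with a := A_r[l] < b := A_{r'}[l']. Assume: (i) if l < n_r then A_r[l+1] ≥ b; (ii) if l' > 1 then A_{r'}[l'−1] ≤ a; (iii) no query value lies in the interval [a, b], i.e., for every i ∈ {1,…,m}, q_i < a or q_i > b. Let x' be the configuration obtained from x by exchanging the two entry values, i.e., setting A_r[l] := b and A_{r'}[l'] := a, leaving all other coordinates (including q and p) unchanged. Then x' ∈ W, and x and x' lie in the same path-connected component of W. -/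
/-- Changing one value of a monotone function keeps it monotone if the new value lies between
the values before and after it. -/
theorem Monotone.update_of_le {ι α : Type*} [LinearOrder ι] [Preorder α] {g : ι → α}
    (hg : Monotone g) {l : ι} {s : α} (hlo : ∀ i < l, g i ≤ s) (hhi : ∀ i, l < i → s ≤ g i) :
    Monotone (Function.update g l s) := by
  intro i j hij
  rcases eq_or_ne i l with rfl | hi <;> rcases eq_or_ne j i with rfl | hj
  · exact le_rfl
  · simpa [hj] using hhi j (lt_of_le_of_ne hij hj.symm)
  · exact le_rfl
  · rcases eq_or_ne j l with rfl | hjl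
    · simpa [hi] using hlo i (lt_of_le_of_ne hij hi)
    · simpa [hi, hjl] using hg hij

/-- The configuration obtained from `x` by setting `A_r[l] := s` and `A_{r'}[l'] := t`. -/
def setEntries {k m : ℕ} {sizes : Fin k → ℕ} (x : Config k m sizes)
    (r r' : Fin k) (l : Fin (sizes r)) (l' : Fin (sizes r')) (s t : ℝ) : Config k m sizes :=
  (Function.update (Function.update x.1 r (Function.update (x.1 r) l s)) r'
    (Function.update (x.1 r') l' t), x.2.1, x.2.2)

section setEntries

variable {k m : ℕ} {sizes : Fin k → ℕ} (x : Config k m sizes)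
  {r r' : Fin k} (l : Fin (sizes r)) (l' : Fin (sizes r')) (s t : ℝ)

theorem setEntries_left (hrr' : r ≠ r') :
    (setEntries x r r' l l' s t).1 r = Function.update (x.1 r) l s := by
  simp [setEntries, hrr']

theorem setEntries_right :
    (setEntries x r r' l l' s t).1 r' = Function.update (x.1 r') l' t := by
  simp [setEntries]

theorem setEntries_of_ne {i : Fin k} (hi : i ≠ r) (hi' : i ≠ r') :
    (setEntries x r r' l l' s t).1 i = x.1 i := by
  simp [setEntries, hi, hi']

theorem setEntries_self :
    setEntries x r r' l l' (x.1 r l) (x.1 r' l') = x := by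
  simp only [setEntries, Function.update_eq_self]

theorem continuous_setEntries :
    Continuous fun u : ℝ × ℝ => setEntries x r r' l l' u.1 u.2 := by
  unfold setEntries
  fun_prop

/-- Every entry after the change is one of the two new values or an old entry. -/
theorem setEntries_apply_cases (hrr' : r ≠ r') (i : Fin k) (j : Fin (sizes i)) :
    (setEntries x r r' l l' s t).1 i j = s ∨ (setEntries x r r' l l' s t).1 i j = t ∨
      (setEntries x r r' l l' s t).1 i j = x.1 i j := by
  rcases eq_or_ne i r with rfl | hi
  · rw [setEntries_left x l l' s t hrr']
    rcases eq_or_ne j l with rfl | hj <;> simp [*]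
  rcases eq_or_ne i r' with rfl | hi'
  · rw [setEntries_right]
    rcases eq_or_ne j l' with rfl | hj <;> simp [*]
  · simp [setEntries_of_ne x l l' s t hi hi']

variable {x l l' s t}

/-- The two entries may be moved within `[a, b]` as long as one of them stays at `b`. -/
theorem setEntries_mem_W (hx : x ∈ W k m sizes) (hrr' : r ≠ r') (hab : x.1 r l < x.1 r' l')
    (hnext : ∀ i, l < i → x.1 r' l' ≤ x.1 r i) (hprev : ∀ i < l', x.1 r' i ≤ x.1 r l)
    (hq : ∀ i : Fin m, x.2.1 i < x.1 r l ∨ x.1 r' l' < x.2.1 i)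
    (hs : s ∈ Set.Icc (x.1 r l) (x.1 r' l')) (ht : t ∈ Set.Icc (x.1 r l) (x.1 r' l'))
    (hst : s = x.1 r' l' ∨ t = x.1 r' l') :
    setEntries x r r' l l' s t ∈ W k m sizes := by
  have left := setEntries_left x l l' s t hrr'
  have right := setEntries_right x l l' s t (r := r)
  obtain ⟨hmono, hpred⟩ := hx
  refine ⟨fun i => ?_, fun j => ?_⟩
  · rcases eq_or_ne i r with rfl | hi
    · rw [left]
      exact (hmono i).update_of_le (fun i h => (hmono _ h.le).trans hs.1)
        fun i h => hs.2.trans (hnext i h)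
    rcases eq_or_ne i r' with rfl | hi'
    · rw [right]
      exact (hmono i).update_of_le (fun i h => (hprev i h).trans ht.1)
        fun i h => ht.2.trans (hmono _ h.le)
    · rw [setEntries_of_ne x l l' s t hi hi']
      exact hmono i
  obtain ⟨⟨i, e, he⟩, hlt, hmax⟩ := hpred j
  change (∃ i e, (setEntries x r r' l l' s t).1 i e = x.2.2 j) ∧ x.2.2 j < x.2.1 j ∧
    ∀ i e, (setEntries x r r' l l' s t).1 i e < x.2.1 j →
      (setEntries x r r' l l' s t).1 i e ≤ x.2.2 j
  have above (v : ℝ) (hv : x.1 r l ≤ v) (hvq : v < x.2.1 j) : x.1 r' l' ≤ x.2.2 j :=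
    hmax r' l' ((hq j).resolve_left (hv.trans_lt hvq).not_gt)
  refine ⟨?_, hlt, fun i e h => ?_⟩
  · rcases eq_or_ne i r with rfl | hi
    · have hel : e ≠ l := by
        rintro rfl
        exact (above _ le_rfl (he ▸ hlt)).not_gt (he ▸ hab)
      exact ⟨i, e, by simp [left, hel, he]⟩
    rcases eq_or_ne i r' with rfl | hi'
    · rcases eq_or_ne e l' with rfl | hel
      · rcases hst with rfl | rfl
        · exact ⟨r, l, by rw [left, Function.update_self, he]⟩
        · exact ⟨i, e, by rw [right, Function.update_self, he]⟩
      · exact ⟨i, e, by simp [right, hel, he]⟩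
    · exact ⟨i, e, by rw [setEntries_of_ne x l l' s t hi hi', he]⟩
  · rcases setEntries_apply_cases x l l' s t hrr' i e with h' | h' | h' <;> rw [h'] at h ⊢
    · exact hs.2.trans (above s hs.1 h)
    · exact ht.2.trans (above t ht.1 h)
    · exact hmax i e h

end setEntries

/-- Swapping two array entries `a = A_r[l] < b = A_{r'}[l']` from different arrays
(`r ≠ r'`) keeps us inside `W` and stays in the same path-connected component of `W`,
provided (i) the successor of position `l` in array `r` (if any) is at least `b`,
(ii) the predecessor of position `l'` in array `r'` (if any) is at most `a`, and
(iii) no query value lies in the interval `[a, b]`. -/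
theorem stmt9 (k m : ℕ) (sizes : Fin k → ℕ)
    (hk : 1 ≤ k) (hm : 1 ≤ m) (hsizes : ∀ i, 1 ≤ sizes i)
    (x : Config k m sizes) (hx : x ∈ W k m sizes)
    (r r' : Fin k) (hrr' : r ≠ r') (l : Fin (sizes r)) (l' : Fin (sizes r'))
    (hab : x.1 r l < x.1 r' l')
    (hnext : ∀ h : (l : ℕ) + 1 < sizes r, x.1 r' l' ≤ x.1 r ⟨(l : ℕ) + 1, h⟩)
    (hprev : 0 < (l' : ℕ) →
      x.1 r' ⟨(l' : ℕ) - 1, Nat.lt_of_le_of_lt (Nat.sub_le _ _) l'.isLt⟩ ≤ x.1 r l)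
    (hq : ∀ i : Fin m, x.2.1 i < x.1 r l ∨ x.1 r' l' < x.2.1 i)
    (x' : Config k m sizes)
    (hx' : x' = (Function.update
        (Function.update x.1 r (Function.update (x.1 r) l (x.1 r' l'))) r'
        (Function.update (x.1 r') l' (x.1 r l)),
      x.2.1, x.2.2)) :
    x' ∈ W k m sizes ∧ JoinedIn (W k m sizes) x x' := by
  have hnext' (i) (hi : l < i) : x.1 r' l' ≤ x.1 r i :=
    (hnext (lt_of_le_of_lt (Nat.succ_le_of_lt hi) i.isLt)).trans (hx.1 r (Nat.succ_le_of_lt hi))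
  have hprev' (i) (hi : i < l') : x.1 r' i ≤ x.1 r l :=
    (hx.1 r' (Nat.le_sub_one_of_lt hi)).trans (hprev (Nat.zero_lt_of_lt hi))
  have joined : JoinedIn (Set.Icc (x.1 r l) (x.1 r' l')) (x.1 r l) (x.1 r' l') :=
    ((convex_Icc _ _).isPathConnected ⟨_, Set.left_mem_Icc.2 hab.le⟩).joinedIn
      _ (Set.left_mem_Icc.2 hab.le) _ (Set.right_mem_Icc.2 hab.le)
  have raise : JoinedIn (W k m sizes) x
      (setEntries x r r' l l' (x.1 r' l') (x.1 r' l')) := by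
    have h := joined.map (f := fun s => setEntries x r r' l l' s (x.1 r' l'))
      ((continuous_setEntries x l l').comp (by fun_prop : Continuous fun s : ℝ => (s, x.1 r' l')))
    rw [setEntries_self] at h
    refine h.mono ?_
    rintro _ ⟨s, hs, rfl⟩
    exact setEntries_mem_W hx hrr' hab hnext' hprev' hq hs (Set.right_mem_Icc.2 hab.le) (.inr rfl)
  have lower : JoinedIn (W k m sizes) (setEntries x r r' l l' (x.1 r' l') (x.1 r' l')) x' := by
    have h := joined.symm.map (f := fun t => setEntries x r r' l l' (x.1 r' l') t)
      ((continuous_setEntries x l l').comp (by fun_prop : Continuous fun t : ℝ => (x.1 r' l', t)))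
    rw [hx']
    refine h.mono ?_
    rintro _ ⟨t, ht, rfl⟩
    exact setEntries_mem_W hx hrr' hab hnext' hprev' hq (Set.right_mem_Icc.2 hab.le) ht (.inl rfl)
  exact ⟨lower.target_mem, raise.trans lower⟩
end

section
/- Let n, k, s be positive integers with k dividing n and s dividing n, suppose every array has the balanced size n_i = n/k for all i ∈ {1,…,k}, and suppose m = n/s. Then the number of connected components of W is at least (k/(e·s))^n, where e is Euler's number. -/
/-- Families of `k` monotone words of length `N` over `{0, …, m}` in which the letter `0` occurs. -/
abbrev MonotoneWords (k N m : ℕ) : Type :=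
  {f : Fin k → Fin N → Fin (m + 1) // (∀ i, Monotone (f i)) ∧ ∃ i l, f i l = 0}

theorem pow_le_card_monotoneWords {k N m : ℕ} (hk : 0 < k) (hN : 0 < N) :
    (m + 1) ^ (k * N) ≤
      N.factorial ^ k * ((m + 1) * Fintype.card (MonotoneWords k N m)) := by
  classical
  let i₀ : Fin k := ⟨0, hk⟩
  let l₀ : Fin N := ⟨0, hN⟩
  let sorted (f : Fin k → Fin N → Fin (m + 1)) (i : Fin k) (l : Fin N) : Fin (m + 1) :=
    f i (Tuple.sort (f i) l)
  have sorted_mono (f) (i) : Monotone (sorted f i) := Tuple.monotone_sort (f i)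
  let lowered (f : Fin k → Fin N → Fin (m + 1)) : MonotoneWords k N m :=
    ⟨fun i l => if i = i₀ ∧ l = l₀ then 0 else sorted f i l, by
      refine ⟨fun i a b hab => ?_, i₀, l₀, by simp⟩
      dsimp only
      split_ifs with ha hb hb
      · exact le_rfl
      · exact Fin.zero_le _
      · refine absurd ⟨hb.1, ?_⟩ ha
        have : a ≤ l₀ := hb.2 ▸ hab
        exact Fin.ext (Nat.le_zero.mp this)
      · exact sorted_mono f i hab⟩
  let code (f : Fin k → Fin N → Fin (m + 1)) :
      (Fin k → Equiv.Perm (Fin N)) × (Fin (m + 1) × MonotoneWords k N m) :=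
    (fun i => Tuple.sort (f i), sorted f i₀ l₀, lowered f)
  have code_injective : Function.Injective code := by
    intro f g hfg
    have hperm : ∀ i, Tuple.sort (f i) = Tuple.sort (g i) := congrFun (congrArg Prod.fst hfg)
    have hfirst : sorted f i₀ l₀ = sorted g i₀ l₀ := congrArg (fun c => c.2.1) hfg
    have hlow : (lowered f).1 = (lowered g).1 := congrArg (fun c => c.2.2.1) hfg
    have hsorted : ∀ i l, sorted f i l = sorted g i l := by
      intro i l
      by_cases h : i = i₀ ∧ l = l₀
      · rw [h.1, h.2, hfirst]
      · simpa [lowered, h] using congrFun (congrFun hlow i) l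
    funext i l
    have h := hsorted i ((Tuple.sort (f i)).symm l)
    simp only [sorted] at h
    rwa [← hperm i, Equiv.apply_symm_apply] at h
  have h := Fintype.card_le_of_injective code code_injective
  simpa [Fintype.card_perm, ← pow_mul, mul_comm N k] using h

theorem div_exp_pow_le_card_monotoneWords {k N s m : ℕ} (hk : 0 < k) (hN : 0 < N) (hs : 0 < s)
    (h : k * N = s * m) :
    ((k : ℝ) / (Real.exp 1 * s)) ^ (k * N) ≤ Fintype.card (MonotoneWords k N m) := by
  have hcount : ((m : ℝ) + 1) ^ (k * N) ≤
      (N : ℝ) ^ (k * N) * ((m + 1) * Fintype.card (MonotoneWords k N m)) := by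
    have hfac : N.factorial ^ k ≤ N ^ (k * N) := by
      rw [mul_comm k N, pow_mul]
      exact Nat.pow_le_pow_left N.factorial_le_pow k
    exact_mod_cast (pow_le_card_monotoneWords hk hN).trans (Nat.mul_le_mul_right _ hfac)
  have hexp : (m : ℝ) + 1 ≤ Real.exp 1 ^ (k * N) := by
    rw [← Real.exp_nat_mul, mul_one]
    have hm : (m : ℝ) ≤ (k * N : ℕ) := by
      rw [h]
      exact_mod_cast Nat.le_mul_of_pos_left m hs
    exact (add_le_add_left hm 1).trans (Real.add_one_le_exp _)
  have hs' : (0 : ℝ) < s := by exact_mod_cast hs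
  have hN' : (0 : ℝ) < N := by exact_mod_cast hN
  have hratio : (k : ℝ) / (Real.exp 1 * s) = m / (N * Real.exp 1) := by
    have h' : (k : ℝ) * N = s * m := by exact_mod_cast h
    field_simp
    linarith
  rw [hratio, div_pow, mul_pow, div_le_iff₀ (by positivity)]
  calc (m : ℝ) ^ (k * N) ≤ ((m : ℝ) + 1) ^ (k * N) := by gcongr; linarith
    _ ≤ (N : ℝ) ^ (k * N) * ((m + 1) * Fintype.card (MonotoneWords k N m)) := hcount
    _ ≤ (N : ℝ) ^ (k * N) * (Real.exp 1 ^ (k * N) * Fintype.card (MonotoneWords k N m)) := by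
        gcongr
    _ = _ := by ring

theorem entry_lt_query_iff_of_mk_eq {k m : ℕ} {sizes : Fin k → ℕ} {x y : W k m sizes}
    (hxy : (x : ConnectedComponents (W k m sizes)) = y) (r : Fin k) (l : Fin (sizes r))
    (j : Fin m) : x.1.1 r l < x.1.2.1 j ↔ y.1.1 r l < y.1.2.1 j := by
  have hU := isClopen_setOf_entry_lt_query r l j
  have hc := ConnectedComponents.coe_eq_coe.mp hxy
  constructor <;> intro h
  · exact hU.connectedComponent_subset h (hc ▸ mem_connectedComponent)
  · exact hU.connectedComponent_subset h (hc ▸ mem_connectedComponent)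

/-- Monotone words are realised by valid configurations: the letters are the array entries, and
the `j`-th query lies strictly between `j` and `j + 1`. -/
theorem exists_mem_W_entry_lt_query_iff {k N m : ℕ} (f : MonotoneWords k N m) :
    ∃ x : W k m (fun _ => N), ∀ r l j, x.1.1 r l < x.1.2.1 j ↔ (f.1 r l : ℕ) ≤ j := by
  classical
  obtain ⟨f, hmono, i₀, l₀, hzero⟩ := f
  have hlt (a b : ℕ) : (a : ℝ) < (b : ℝ) + 1 / 2 ↔ a ≤ b := by
    constructor
    · intro h
      have : (a : ℝ) < (b + 1 : ℕ) := by push_cast; linarith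
      exact Nat.lt_succ_iff.mp (by exact_mod_cast this)
    · intro h
      have : (a : ℝ) ≤ b := by exact_mod_cast h
      linarith
  have hpred (j : Fin m) : ∃ c : Fin k × Fin N, (f c.1 c.2 : ℕ) ≤ j ∧
      ∀ c' : Fin k × Fin N, (f c'.1 c'.2 : ℕ) ≤ j → f c'.1 c'.2 ≤ f c.1 c.2 := by
    obtain ⟨c, hc, hmax⟩ := Finset.exists_max_image
      (Finset.univ.filter fun c : Fin k × Fin N => (f c.1 c.2 : ℕ) ≤ j)
      (fun c => f c.1 c.2) ⟨(i₀, l₀), by simp [hzero]⟩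
    exact ⟨c, by simpa using hc, fun c' hc' => hmax c' (by simpa using hc')⟩
  choose c hc hmax using hpred
  refine ⟨⟨(fun r l => ((f r l : ℕ) : ℝ), fun j => ((j : ℕ) : ℝ) + 1 / 2,
    fun j => ((f (c j).1 (c j).2 : ℕ) : ℝ)), ?_, ?_⟩, fun r l j => hlt _ _⟩
  · intro i a b hab
    exact Nat.cast_le.mpr (hmono i hab)
  · intro j
    refine ⟨⟨(c j).1, (c j).2, rfl⟩, (hlt _ _).mpr (hc j), fun r l h => ?_⟩
    exact Nat.cast_le.mpr (hmax j (r, l) ((hlt _ _).mp h))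

theorem card_monotoneWords_le_mk_connectedComponents (k N m : ℕ) :
    (Fintype.card (MonotoneWords k N m) : Cardinal) ≤
      Cardinal.mk (ConnectedComponents (W k m fun _ => N)) := by
  choose x hx using exists_mem_W_entry_lt_query_iff (k := k) (N := N) (m := m)
  rw [← Cardinal.mk_fintype]
  refine Cardinal.mk_le_of_injective
    (f := fun f => (x f : ConnectedComponents (W k m fun _ => N))) fun f g hfg => ?_
  have hiff (r : Fin k) (l : Fin N) (j : Fin m) : (f.1 r l : ℕ) ≤ j ↔ (g.1 r l : ℕ) ≤ j := by
    rw [← hx f, ← hx g]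
    exact entry_lt_query_iff_of_mk_eq hfg r l j
  refine Subtype.ext (funext fun r => funext fun l => Fin.ext ?_)
  by_contra hne
  rcases lt_or_gt_of_ne hne with h | h
  · exact h.not_ge ((hiff r l ⟨f.1 r l, by omega⟩).mp le_rfl)
  · exact h.not_ge ((hiff r l ⟨g.1 r l, by omega⟩).mpr le_rfl)

/-- With `k ∣ n` balanced arrays of size `n/k` each, `s ∣ n`, and `m = n/s` queries,
the number of connected components of `W` is at least `(k/(e·s))^n`, where `e` is
Euler's number (as this bound is a real number, the cardinality is at least its
integer ceiling). -/
theorem stmt10 (n k s m : ℕ) (sizes : Fin k → ℕ)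
    (hn : 0 < n) (hk : 0 < k) (hs : 0 < s) (hkd : k ∣ n) (hsd : s ∣ n)
    (hsizes : ∀ i, sizes i = n / k) (hm : m = n / s) :
    (↑⌈((k : ℝ) / (Real.exp 1 * s)) ^ n⌉₊ : Cardinal) ≤
      Cardinal.mk (ConnectedComponents (W k m sizes)) := by
  obtain rfl : sizes = fun _ => n / k := funext hsizes
  obtain ⟨N, rfl⟩ := hkd
  have hsm : k * N = s * m := by rw [hm, Nat.mul_div_cancel' hsd]
  rw [Nat.mul_div_cancel_left N hk]
  refine le_trans ?_ (card_monotoneWords_le_mk_connectedComponents k N m)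
  exact_mod_cast Nat.ceil_le.mpr
    (div_exp_pow_le_card_monotoneWords hk (Nat.pos_of_mul_pos_left hn) hs hsm)
end
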